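/- arXiv:1706.02199 — 3 statements merged into one kernel-verified Lean document; each statement's English description precedes it below -/
import Mathlib

section
/- The regularization P_ε is a probability density on (ℝ^d)^N: P_ε ≥ 0 everywhere and ∫_{(ℝ^d)^N} P_ε(x₁,…,x_N) dx₁⋯dx_N = 1. -/
open MeasureTheory Real

noncomputable section

/-- `ℝ^d` as a Euclidean space. -/
abbrev Euc (d : ℕ) := EuclideanSpace ℝ (Fin d)

/-- Rescaled mollifier `χ_ε(x) = ε^{-d/2} χ(x/ε)`. -/
def chiE (d : ℕ) (χ : Euc d → ℝ) (ε : ℝ) (x : Euc d) : ℝ :=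
  ε ^ (-(d : ℝ) / 2) * χ (ε⁻¹ • x)

/-- Convolution `(ρ ∗ g²)(z) = ∫ ρ(x) g(z - x)² dx`. -/
def convSq (d : ℕ) (ρ : Euc d → ℝ) (g : Euc d → ℝ) (z : Euc d) : ℝ :=
  ∫ x : Euc d, ρ x * (g (z - x)) ^ 2

/-- The Bindini–De Pascale regularization `P_ε` (division by zero is `0` in Lean,
matching the convention that quotients with zero denominator are interpreted as `0`). -/
def Peps (d N : ℕ) (χ : Euc d → ℝ) (ε : ℝ) (ρ : Euc d → ℝ)
    (P : Measure (Fin N → Euc d)) (X : Fin N → Euc d) : ℝ :=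
  ∫ Z : Fin N → Euc d, ∫ Y : Fin N → Euc d,
    (∏ k, ρ (X k) * (chiE d χ ε (X k - Z k)) ^ 2 * (chiE d χ ε (Z k - Y k)) ^ 2
      / convSq d ρ (chiE d χ ε) (Z k)) ∂P

/-- The set `D^c_α` of configurations where all particles are at distance at least `α`. -/
def Dc (d N : ℕ) (α : ℝ) : Set (Fin N → Euc d) :=
  {X | ∀ i j, i ≠ j → α ≤ ‖X i - X j‖}

/-- The gradient of `Φ` with respect to the `j`-th `ℝ^d` coordinate block. -/
def blockGrad (d N : ℕ) (Φ : (Fin N → Euc d) → ℝ) (j : Fin N) (X : Fin N → Euc d) : Euc d :=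
  gradient (fun v => Φ (Function.update X j v)) (X j)

/-- The second derivative `∇_j ∇_k Φ`, as a continuous linear map on `ℝ^d`. -/
def blockGrad2 (d N : ℕ) (Φ : (Fin N → Euc d) → ℝ) (j k : Fin N) (X : Fin N → Euc d) :
    Euc d →L[ℝ] Euc d :=
  fderiv ℝ (fun w => blockGrad d N Φ j (Function.update X k w)) (X k)

/-- Tonelli's theorem for a product of functions of separate variables. -/
theorem lintegral_fin_prod_eq_prod {N : ℕ} {E : Type*} [MeasurableSpace E] (μ : Measure E)
    [SigmaFinite μ] (f : Fin N → E → ENNReal) (hf : ∀ i, Measurable (f i)) :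
    ∫⁻ X : Fin N → E, ∏ i, f i (X i) ∂(Measure.pi fun _ => μ) = ∏ i, ∫⁻ x, f i x ∂μ := by
  induction N with
  | zero => simp
  | succ n ih =>
    have hmp := (measurePreserving_piFinSuccAbove (fun _ : Fin (n + 1) => μ) 0).symm
    rw [← hmp.lintegral_comp_emb (MeasurableEquiv.measurableEmbedding _)]
    simp_rw [Fin.prod_univ_succ]
    simp only [MeasurableEquiv.piFinSuccAbove_symm_apply, Fin.insertNthEquiv, Equiv.coe_fn_mk,
      Fin.insertNth_zero', Fin.cons_zero, Fin.cons_succ]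
    have hm : Measurable fun Y : Fin n → E => ∏ i, f i.succ (Y i) :=
      Finset.measurable_fun_prod _ fun i _ => (hf _).comp (measurable_pi_apply i)
    refine (lintegral_prod_mul (hf 0).aemeasurable hm.aemeasurable).trans ?_
    rw [ih _ fun i => hf i.succ]

/-- Regularizing a coupling with marginals of density `r` by a symmetric Markov kernel `g`, and
reweighting by the inverse `w` of the regularized density, preserves the total mass. -/
theorem lintegral_regularization_eq_one {N : ℕ} {E : Type*} [MeasurableSpace E] (μ : Measure E)
    [SigmaFinite μ] (r w : E → ENNReal) (g : E → E → ENNReal)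
    (hr : Measurable r) (hw : Measurable w) (hg : Measurable (Function.uncurry g))
    (hg_symm : ∀ x z, g x z = g z x) (hg_one : ∀ y, ∫⁻ z, g z y ∂μ = 1)
    (hwc : ∀ z, ∫⁻ x, r x * g x z ∂μ ≠ 0 → w z * ∫⁻ x, r x * g x z ∂μ = 1)
    (P : Measure (Fin N → E)) [IsProbabilityMeasure P]
    (hP : ∀ k, P.map (fun X => X k) = μ.withDensity r) :
    ∫⁻ Y, ∫⁻ Z, ∫⁻ X, ∏ k, r (X k) * g (X k) (Z k) * g (Z k) (Y k) * w (Z k)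
      ∂(Measure.pi fun _ => μ) ∂(Measure.pi fun _ => μ) ∂P = 1 := by
  set c : E → ENNReal := fun z => ∫⁻ x, r x * g x z ∂μ with hc
  have hg' : ∀ y, Measurable fun z => g z y := fun y =>
    hg.comp (measurable_id.prodMk measurable_const)
  have hrg : Measurable (Function.uncurry fun z x => r x * g x z) :=
    (hr.comp measurable_snd).mul (hg.comp measurable_swap)
  have hcm : Measurable c := hrg.lintegral_prod_right'
  have hB : MeasurableSet {z | c z = 0} := hcm (measurableSet_singleton 0)
  have key : ∀ᵐ y ∂(μ.withDensity r), ∫⁻ z, c z * g z y * w z ∂μ = 1 := by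
    have h0 : ∫⁻ y, r y * ∫⁻ z in {z | c z = 0}, g z y ∂μ ∂μ = 0 := by
      rw [lintegral_congr fun y => (lintegral_const_mul (r y) (hg' y)).symm,
        lintegral_lintegral_swap]
      · refine setLIntegral_eq_zero hB fun z hz => ?_
        rw [Pi.zero_apply, ← show c z = 0 from hz]
        exact lintegral_congr fun y => by rw [hg_symm]
      · exact ((hr.comp measurable_fst).mul (hg.comp measurable_swap)).aemeasurable
    have hgm : Measurable fun y => ∫⁻ z in {z | c z = 0}, g z y ∂μ :=
      Measurable.lintegral_prod_right' (f := fun p : E × E => g p.2 p.1) (hg.comp measurable_swap)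
    rw [lintegral_eq_zero_iff (hr.fun_mul hgm)] at h0
    rw [ae_withDensity_iff hr]
    filter_upwards [h0] with y hy hry
    have hy0 : ∫⁻ z in {z | c z = 0}, g z y ∂μ = 0 := by
      simpa [hry] using hy
    have hae := (ae_restrict_iff' hB).1 ((lintegral_eq_zero_iff (hg' y)).1 hy0)
    rw [← hg_one y]
    refine lintegral_congr_ae ?_
    filter_upwards [hae] with z hz
    by_cases h : c z = 0
    · simp [show g z y = 0 from hz h]
    · rw [mul_right_comm, mul_comm (c z), hwc z h, one_mul]
  have hX : ∀ Y Z : Fin N → E,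
      ∫⁻ X, ∏ k, r (X k) * g (X k) (Z k) * g (Z k) (Y k) * w (Z k) ∂(Measure.pi fun _ => μ)
        = ∏ k, c (Z k) * g (Z k) (Y k) * w (Z k) := by
    intro Y Z
    rw [lintegral_fin_prod_eq_prod μ (fun k x => r x * g x (Z k) * g (Z k) (Y k) * w (Z k))
      fun k => ((hr.mul (hg' _)).mul_const _).mul_const _]
    refine Finset.prod_congr rfl fun k _ => ?_
    rw [lintegral_mul_const _ ((hr.fun_mul (hg' _)).mul_const _),
      lintegral_mul_const _ (hr.fun_mul (hg' _))]
  simp_rw [hX]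
  have hZ : ∀ Y : Fin N → E, ∫⁻ Z, ∏ k, c (Z k) * g (Z k) (Y k) * w (Z k) ∂(Measure.pi fun _ => μ)
      = ∏ k, ∫⁻ z, c z * g z (Y k) * w z ∂μ := fun Y =>
    lintegral_fin_prod_eq_prod μ (fun k z => c z * g z (Y k) * w z)
      fun k => (hcm.mul (hg' _)).mul hw
  simp_rw [hZ]
  have hall : ∀ᵐ Y ∂P, ∀ k, ∫⁻ z, c z * g z (Y k) * w z ∂μ = 1 := by
    refine ae_all_iff.2 fun k => ?_
    have := key
    rw [← hP k] at this
    exact ae_of_ae_map (measurable_pi_apply k).aemeasurable this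
  rw [lintegral_congr_ae (g := fun _ => 1)]
  · simp
  · filter_upwards [hall] with Y hY
    simp [hY]

/-- Rescaling in `L²` preserves the norm. -/
theorem integral_chiE_sq (d : ℕ) (χ : Euc d → ℝ) (ε : ℝ) (hε : 0 < ε) :
    ∫ x, chiE d χ ε x ^ 2 = ∫ x, χ x ^ 2 := by
  simp_rw [chiE, mul_pow, integral_const_mul]
  rw [Measure.integral_comp_inv_smul_of_nonneg volume (fun x => χ x ^ 2) hε.le,
    ← Real.rpow_natCast (ε ^ _), ← Real.rpow_mul hε.le, finrank_euclideanSpace_fin, smul_eq_mul,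
    ← mul_assoc, ← Real.rpow_natCast ε d, ← Real.rpow_add hε]
  simp

theorem map_eval_eq_of_symmetric {N : ℕ} {E : Type*} [MeasurableSpace E]
    (P : Measure (Fin N → E)) (hP : ∀ σ : Equiv.Perm (Fin N), P.map (fun X => X ∘ σ) = P)
    (j k : Fin N) : P.map (fun X => X k) = P.map (fun X => X j) := by
  conv_rhs => rw [← hP (Equiv.swap j k)]
  rw [Measure.map_map (measurable_pi_apply j) (by fun_prop)]
  congr 1
  ext X
  simp

/-- `P_ε` is a probability density: it is nonnegative and integrates to `1`. -/
theorem bindiniDePascale_isProbabilityDensity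
    (d N : ℕ) (hd : 1 ≤ d) (hN : 2 ≤ N)
    (χ : Euc d → ℝ) (hχ_smooth : ContDiff ℝ (⊤ : ℕ∞) χ)
    (hχ_supp : Function.support χ ⊆ Metric.closedBall 0 1)
    (hχ_radial : ∀ x y : Euc d, ‖x‖ = ‖y‖ → χ x = χ y)
    (hχ_norm : ∫ x : Euc d, (χ x) ^ 2 = 1)
    (ε : ℝ) (hε : 0 < ε)
    (P : Measure (Fin N → Euc d)) [IsProbabilityMeasure P]
    (hP_symm : ∀ σ : Equiv.Perm (Fin N), P.map (fun X => X ∘ σ) = P)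
    (ρ : Euc d → ℝ) (hρ_nonneg : ∀ x, 0 ≤ ρ x) (hρ_meas : Measurable ρ)
    (hP_marginal : P.map (fun X => X (⟨0, by omega⟩ : Fin N))
      = volume.withDensity (fun x => ENNReal.ofReal (ρ x)))
 :
    (∀ X : Fin N → Euc d, 0 ≤ Peps d N χ ε ρ P X) ∧
      ∫ X : Fin N → Euc d, Peps d N χ ε ρ P X = 1 := by
  have hχc : Continuous χ := hχ_smooth.continuous
  have hgc : Continuous (chiE d χ ε) := by unfold chiE; fun_prop
  have hodd : ∀ x z, chiE d χ ε (x - z) = chiE d χ ε (z - x) := fun x z => by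
    unfold chiE
    rw [hχ_radial (ε⁻¹ • (x - z)) (ε⁻¹ • (z - x)) (by simp only [norm_smul, norm_sub_rev])]
  have hc_nonneg : ∀ z, 0 ≤ convSq d ρ (chiE d χ ε) z := fun z =>
    integral_nonneg fun x => mul_nonneg (hρ_nonneg x) (sq_nonneg _)
  have hF_nonneg : ∀ X Z Y : Fin N → Euc d, 0 ≤ ∏ k, ρ (X k) * (chiE d χ ε (X k - Z k)) ^ 2 *
      (chiE d χ ε (Z k - Y k)) ^ 2 / convSq d ρ (chiE d χ ε) (Z k) := fun X Z Y =>
    Finset.prod_nonneg fun k _ => div_nonneg (mul_nonneg (mul_nonneg (hρ_nonneg _) (sq_nonneg _))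
      (sq_nonneg _)) (hc_nonneg _)
  refine ⟨fun X => integral_nonneg fun Z => integral_nonneg fun Y => hF_nonneg X Z Y, ?_⟩
  have hP : ∀ k, P.map (fun X => X k) = volume.withDensity fun x => ENNReal.ofReal (ρ x) :=
    fun k => (map_eval_eq_of_symmetric P hP_symm _ k).trans hP_marginal
  have hρ_int : Integrable ρ := by
    refine ⟨hρ_meas.aestronglyMeasurable, ?_⟩
    rw [hasFiniteIntegral_iff_ofReal (Filter.Eventually.of_forall hρ_nonneg),
      ← setLIntegral_univ, ← withDensity_apply _ MeasurableSet.univ, ← hP_marginal]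
    rw [Measure.map_apply (measurable_pi_apply _) MeasurableSet.univ]
    exact measure_lt_top _ _
  have hχ_cpt : HasCompactSupport χ :=
    HasCompactSupport.of_support_subset_isCompact (isCompact_closedBall 0 1) hχ_supp
  obtain ⟨C, hC⟩ := hχ_cpt.exists_bound_of_continuous hχc
  have hc_int : ∀ z, Integrable fun x => ρ x * chiE d χ ε (z - x) ^ 2 := fun z => by
    refine hρ_int.mul_bdd (c := (ε ^ (-(d : ℝ) / 2) * C) ^ 2)
      (by fun_prop) (Filter.Eventually.of_forall fun x => ?_)
    rw [norm_pow]
    refine pow_le_pow_left₀ (norm_nonneg _) ?_ 2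
    rw [chiE, norm_mul, Real.norm_of_nonneg (Real.rpow_nonneg hε.le _)]
    exact mul_le_mul_of_nonneg_left (hC _) (Real.rpow_nonneg hε.le _)
  have hc_meas : Measurable (convSq d ρ (chiE d χ ε)) := by
    have : StronglyMeasurable fun p : Euc d × Euc d => ρ p.2 * chiE d χ ε (p.1 - p.2) ^ 2 := by
      refine Measurable.stronglyMeasurable ?_
      have := hgc.measurable
      fun_prop
    exact this.integral_prod_right'.measurable
  have hc_lint : ∀ z, ∫⁻ x, ENNReal.ofReal (ρ x) * ENNReal.ofReal (chiE d χ ε (x - z) ^ 2)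
      = ENNReal.ofReal (convSq d ρ (chiE d χ ε) z) := fun z => by
    rw [convSq, ofReal_integral_eq_lintegral_ofReal (hc_int z) (Filter.Eventually.of_forall
      fun x => mul_nonneg (hρ_nonneg x) (sq_nonneg _))]
    simp_rw [ENNReal.ofReal_mul (hρ_nonneg _), hodd z]
  have hg_one : ∀ y, ∫⁻ z, ENNReal.ofReal (chiE d χ ε (z - y) ^ 2) = 1 := fun y => by
    have h1 : ∫ x, chiE d χ ε x ^ 2 = 1 := (integral_chiE_sq d χ ε hε).trans hχ_norm
    rw [lintegral_sub_right_eq_self (fun z => ENNReal.ofReal (chiE d χ ε z ^ 2)),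
      ← ofReal_integral_eq_lintegral_ofReal
        (Integrable.of_integral_ne_zero (by rw [h1]; exact one_ne_zero))
        (Filter.Eventually.of_forall fun x => sq_nonneg _), h1, ENNReal.ofReal_one]
  have hone := lintegral_regularization_eq_one (volume : Measure (Euc d))
    (fun x => ENNReal.ofReal (ρ x)) (fun z => ENNReal.ofReal (convSq d ρ (chiE d χ ε) z)⁻¹)
    (fun x z => ENNReal.ofReal (chiE d χ ε (x - z) ^ 2)) (by fun_prop) (by fun_prop)
    (by have := hgc.measurable; unfold Function.uncurry; fun_prop)
    (fun x z => by rw [hodd]) hg_one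
    (fun z hz => by
      rw [hc_lint] at hz ⊢
      have hpos : 0 < convSq d ρ (chiE d χ ε) z := by simpa using hz
      rw [← ENNReal.ofReal_mul (inv_nonneg.2 hpos.le), inv_mul_cancel₀ hpos.ne',
        ENNReal.ofReal_one]) P hP
  set F : (Fin N → Euc d) × (Fin N → Euc d) × (Fin N → Euc d) → ℝ := fun p =>
    ∏ k, ρ (p.1 k) * (chiE d χ ε (p.1 k - p.2.1 k)) ^ 2 * (chiE d χ ε (p.2.1 k - p.2.2 k)) ^ 2
      / convSq d ρ (chiE d χ ε) (p.2.1 k) with hF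
  have hF0 : ∀ p, 0 ≤ F p := fun p => hF_nonneg p.1 p.2.1 p.2.2
  have hF_meas : Measurable F := by
    have := hgc.measurable
    fun_prop
  have : SFinite ((volume : Measure (Fin N → Euc d)).prod P) := Measure.prod.instSFinite
  have hF_lint : ∫⁻ p, ENNReal.ofReal (F p) ∂(volume.prod (volume.prod P)) = 1 := by
    rw [lintegral_prod_symm' _ hF_meas.ennreal_ofReal, lintegral_prod_symm' _
      (Measurable.lintegral_prod_left' hF_meas.ennreal_ofReal), ← hone]
    refine lintegral_congr fun Y => lintegral_congr fun Z => lintegral_congr fun X => ?_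
    rw [hF, ENNReal.ofReal_prod_of_nonneg fun k _ => div_nonneg (mul_nonneg (mul_nonneg
      (hρ_nonneg _) (sq_nonneg _)) (sq_nonneg _)) (hc_nonneg _)]
    refine Finset.prod_congr rfl fun k _ => ?_
    rw [div_eq_mul_inv, ENNReal.ofReal_mul (mul_nonneg (mul_nonneg (hρ_nonneg _) (sq_nonneg _))
      (sq_nonneg _)), ENNReal.ofReal_mul (mul_nonneg (hρ_nonneg _) (sq_nonneg _)),
      ENNReal.ofReal_mul (hρ_nonneg _)]
  have hF_int : Integrable F (volume.prod (volume.prod P)) := by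
    refine ⟨hF_meas.aestronglyMeasurable, ?_⟩
    rw [hasFiniteIntegral_iff_ofReal (Filter.Eventually.of_forall hF0), hF_lint]
    exact ENNReal.one_lt_top
  have hF_one : ∫ p, F p ∂(volume.prod (volume.prod P)) = 1 := by
    rw [integral_eq_lintegral_of_nonneg_ae (Filter.Eventually.of_forall hF0)
      hF_meas.aestronglyMeasurable, hF_lint, ENNReal.toReal_one]
  rw [← hF_one, integral_prod _ hF_int]
  refine integral_congr_ae ?_
  filter_upwards [hF_int.prod_right_ae] with X hX
  rw [integral_prod _ hX]
  rfl
end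
end

section
/- (Diagonal of the fermionic mixed state equals the Bindini–De Pascale density.) Suppose P is symmetric, supported in D^c_α, and 0 < ε < α/4. Then for every X = (x₁,…,x_N) ∈ (ℝ^d)^N, (1/N!) ∫_{(ℝ^d)^N} ∫_{(ℝ^d)^N} [det( χ_ε(x_j − z_i) )_{1≤i,j≤N}]² ∏_{k=1}^N [ρ_P(x_k) χ_ε(z_k − y_k)² / (ρ_P ∗ χ_ε²)(z_k)] dP(y₁,…,y_N) dz₁⋯dz_N = P_ε(X). -/
open MeasureTheory Real

noncomputable section

theorem Matrix.det_sq_eq_sum_of_columns_disjoint {n : Type*} [Fintype n] [DecidableEq n]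
    (M : Matrix n n ℝ) (h : ∀ i i' j, i ≠ i' → M i j * M i' j = 0) :
    M.det ^ 2 = ∑ σ : Equiv.Perm n, ∏ j, (M (σ j) j) ^ 2 := by
  rw [sq, Matrix.det_apply', Finset.sum_mul_sum]
  refine Finset.sum_congr rfl fun σ _ => ?_
  rw [Finset.sum_eq_single σ]
  · have hs : ((Equiv.Perm.sign σ : ℤ) : ℝ) * ((Equiv.Perm.sign σ : ℤ) : ℝ) = 1 := by
      rcases Int.units_eq_one_or (Equiv.Perm.sign σ) with h | h <;> simp [h]
    rw [mul_mul_mul_comm, hs, one_mul, ← Finset.prod_mul_distrib]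
    exact Finset.prod_congr rfl fun j _ => (sq _).symm
  · intro τ _ hτ
    obtain ⟨j, hj⟩ : ∃ j, σ j ≠ τ j := by
      by_contra! hc
      exact hτ (Equiv.ext fun j => (hc j).symm)
    rw [mul_mul_mul_comm, ← Finset.prod_mul_distrib,
      Finset.prod_eq_zero (Finset.mem_univ j) (h _ _ _ hj), mul_zero]
  · simp

theorem MeasureTheory.integral_sum_comp_of_measurePreserving {Ω ι : Type*} [MeasurableSpace Ω]
    [Fintype ι] [Nonempty ι] {μ : Measure Ω} {T : ι → Ω → Ω}
    (hT : ∀ i, MeasurePreserving (T i) μ μ) {H : Ω → ℝ} (hH : Measurable H)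
    (hH0 : ∀ z, 0 ≤ H z) :
    ∫ z, ∑ i, H (T i z) ∂μ = Fintype.card ι * ∫ z, H z ∂μ := by
  by_cases hint : Integrable H μ
  · have hi (i : ι) : Integrable (fun z => H (T i z)) μ :=
      (hT i).integrable_comp_of_integrable hint
    rw [integral_finsetSum _ fun i _ => hi i]
    have (i : ι) : ∫ z, H (T i z) ∂μ = ∫ z, H z ∂μ := by
      rw [← integral_map (hT i).measurable.aemeasurable hH.aestronglyMeasurable, (hT i).map_eq]
    simp [this]
  · rw [integral_undef hint, mul_zero, integral_undef]
    intro hsum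
    obtain ⟨i⟩ := ‹Nonempty ι›
    refine hint (((hT i).integrable_comp hH.aestronglyMeasurable).1 ?_)
    refine hsum.mono' (hH.comp (hT i).measurable).aestronglyMeasurable (ae_of_all _ fun z => ?_)
    rw [Function.comp_apply, Real.norm_of_nonneg (hH0 _)]
    exact Finset.single_le_sum (f := fun i => H (T i z)) (fun _ _ => hH0 _) (Finset.mem_univ i)

theorem measurable_chiE {d : ℕ} {χ : Euc d → ℝ} (hχ : Measurable χ) (ε : ℝ) :
    Measurable (chiE d χ ε) := by
  unfold chiE
  fun_prop

theorem norm_le_of_chiE_ne_zero {d : ℕ} {χ : Euc d → ℝ}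
    (hχ : Function.support χ ⊆ Metric.closedBall 0 1) {ε : ℝ} (hε : 0 < ε) {x : Euc d}
    (hx : chiE d χ ε x ≠ 0) : ‖x‖ ≤ ε := by
  have h : ‖ε⁻¹ • x‖ ≤ 1 := by simpa using hχ (right_ne_zero_of_mul hx)
  rwa [norm_smul, norm_inv, Real.norm_of_nonneg hε.le, inv_mul_le_one₀ hε] at h

theorem measurable_convSq {d : ℕ} {ρ g : Euc d → ℝ} (hρ : Measurable ρ) (hg : Measurable g) :
    Measurable (convSq d ρ g) := by
  have : Measurable fun p : Euc d × Euc d => ρ p.2 * (g (p.1 - p.2)) ^ 2 := by fun_prop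
  exact this.stronglyMeasurable.integral_prod_right.measurable

theorem convSq_nonneg {d : ℕ} {ρ : Euc d → ℝ} (hρ : ∀ x, 0 ≤ ρ x) (g : Euc d → ℝ) (z : Euc d) :
    0 ≤ convSq d ρ g z :=
  integral_nonneg fun x => mul_nonneg (hρ x) (sq_nonneg _)

/-- The weight `∫ ∏ₖ ρ(xₖ) g(zₖ - yₖ)² / (ρ ∗ g²)(zₖ) dP(y)` of the configuration `Z`. -/
def mixtureWeight (d N : ℕ) (g ρ : Euc d → ℝ) (P : Measure (Fin N → Euc d))
    (X Z : Fin N → Euc d) : ℝ :=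
  ∫ Y, ∏ k, ρ (X k) * (g (Z k - Y k)) ^ 2 / convSq d ρ g (Z k) ∂P

theorem mixtureWeight_nonneg {d N : ℕ} {ρ : Euc d → ℝ} (hρ : ∀ x, 0 ≤ ρ x) (g : Euc d → ℝ)
    (P : Measure (Fin N → Euc d)) (X Z : Fin N → Euc d) : 0 ≤ mixtureWeight d N g ρ P X Z :=
  integral_nonneg fun _ => Finset.prod_nonneg fun _ _ =>
    div_nonneg (mul_nonneg (hρ _) (sq_nonneg _)) (convSq_nonneg hρ _ _)

theorem measurable_mixtureWeight {d N : ℕ} {g ρ : Euc d → ℝ} (hg : Measurable g)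
    (hρ : Measurable ρ) (P : Measure (Fin N → Euc d)) [SFinite P] (X : Fin N → Euc d) :
    Measurable (mixtureWeight d N g ρ P X) := by
  have hc := measurable_convSq hρ hg
  have : Measurable fun p : (Fin N → Euc d) × (Fin N → Euc d) =>
      ∏ k, ρ (X k) * (g (p.1 k - p.2 k)) ^ 2 / convSq d ρ g (p.1 k) := by fun_prop
  exact this.stronglyMeasurable.integral_prod_right.measurable

theorem mixtureWeight_comp_perm {d N : ℕ} {g ρ : Euc d → ℝ} (hg : Measurable g)
    {P : Measure (Fin N → Euc d)}
    (hP : ∀ σ : Equiv.Perm (Fin N), P.map (fun X => X ∘ σ) = P)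
    (X Z : Fin N → Euc d) (σ : Equiv.Perm (Fin N)) :
    mixtureWeight d N g ρ P X (Z ∘ σ) = mixtureWeight d N g ρ P X Z := by
  unfold mixtureWeight
  have hf : Measurable fun Y : Fin N → Euc d =>
      ∏ k, ρ (X k) * (g ((Z ∘ σ) k - Y k)) ^ 2 / convSq d ρ g ((Z ∘ σ) k) := by fun_prop
  have hσ : Measurable fun Y : Fin N → Euc d => Y ∘ σ :=
    measurable_pi_lambda _ fun i => measurable_pi_apply (σ i)
  conv_lhs => rw [← hP σ]
  rw [integral_map hσ.aemeasurable hf.aestronglyMeasurable]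
  refine integral_congr_ae (ae_of_all _ fun Y => ?_)
  simp only [Function.comp_apply, mul_div_assoc, Finset.prod_mul_distrib]
  rw [Equiv.prod_comp σ fun k => (g (Z k - Y k)) ^ 2 / convSq d ρ g (Z k)]

theorem measurePreserving_comp_perm {d N : ℕ} (σ : Equiv.Perm (Fin N)) :
    MeasurePreserving (fun Z : Fin N → Euc d => Z ∘ σ) volume volume :=
  volume_preserving_arrowCongr' σ.symm (MeasurableEquiv.refl (Euc d)) (.id volume)

theorem det_chiE_sq {d N : ℕ} {χ : Euc d → ℝ}
    (hχ : Function.support χ ⊆ Metric.closedBall 0 1) {α ε : ℝ} (hε : 0 < ε) (hεα : ε < α / 4)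
    {X Y Z : Fin N → Euc d} (hY : Y ∈ Dc d N α) (hZY : ∀ k, chiE d χ ε (Z k - Y k) ≠ 0) :
    (Matrix.det (Matrix.of fun i j => chiE d χ ε (X j - Z i))) ^ 2
      = ∑ σ : Equiv.Perm (Fin N), ∏ k, (chiE d χ ε (X k - Z (σ k))) ^ 2 := by
  rw [Matrix.det_sq_eq_sum_of_columns_disjoint]
  · rfl
  intro i i' j hi
  by_contra hne
  have h1 := norm_le_of_chiE_ne_zero hχ hε (left_ne_zero_of_mul hne)
  have h2 := norm_le_of_chiE_ne_zero hχ hε (right_ne_zero_of_mul hne)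
  have h3 := norm_le_of_chiE_ne_zero hχ hε (hZY i)
  have h4 := norm_le_of_chiE_ne_zero hχ hε (hZY i')
  have h5 : Y i - Y i' =
      ((X j - Z i') - (X j - Z i)) + ((Z i' - Y i') - (Z i - Y i)) := by abel
  have h6 := hY i i' hi
  rw [h5] at h6
  have h7 := norm_add_le ((X j - Z i') - (X j - Z i)) ((Z i' - Y i') - (Z i - Y i))
  have h8 := norm_sub_le (X j - Z i') (X j - Z i)
  have h9 := norm_sub_le (Z i' - Y i') (Z i - Y i)
  linarith

/-- the diagonal of the fermionic mixed state `Γ_ε` coincides with the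
Bindini–De Pascale density `P_ε`. -/
theorem diagonal_eq_bindiniDePascale
    (d N : ℕ) (hd : 1 ≤ d) (hN : 2 ≤ N)
    (χ : Euc d → ℝ) (hχ_smooth : ContDiff ℝ (⊤ : ℕ∞) χ)
    (hχ_supp : Function.support χ ⊆ Metric.closedBall 0 1)
    (hχ_radial : ∀ x y : Euc d, ‖x‖ = ‖y‖ → χ x = χ y)
    (hχ_norm : ∫ x : Euc d, (χ x) ^ 2 = 1)
    (α ε : ℝ) (hα : 0 < α) (hε : 0 < ε) (hεα : ε < α / 4)
    (P : Measure (Fin N → Euc d)) [IsProbabilityMeasure P]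
    (hP_symm : ∀ σ : Equiv.Perm (Fin N), P.map (fun X => X ∘ σ) = P)
    (ρ : Euc d → ℝ) (hρ_nonneg : ∀ x, 0 ≤ ρ x) (hρ_meas : Measurable ρ)
    (hP_marginal : P.map (fun X => X (⟨0, by omega⟩ : Fin N))
      = volume.withDensity (fun x => ENNReal.ofReal (ρ x)))
    (hP_supp : ∀ᵐ Y ∂P, Y ∈ Dc d N α)
    (X : Fin N → Euc d) :
    ((N.factorial : ℝ))⁻¹ *
      ∫ Z : Fin N → Euc d, ∫ Y : Fin N → Euc d,
        (Matrix.det (Matrix.of fun i j => chiE d χ ε (X j - Z i))) ^ 2 *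
          ∏ k, ρ (X k) * (chiE d χ ε (Z k - Y k)) ^ 2
            / convSq d ρ (chiE d χ ε) (Z k) ∂P
      = Peps d N χ ε ρ P X := by
  set g := chiE d χ ε with hg_def
  have hg : Measurable g := measurable_chiE hχ_smooth.continuous.measurable ε
  let H : (Fin N → Euc d) → ℝ := fun Z =>
    (∏ k, (g (X k - Z k)) ^ 2) * mixtureWeight d N g ρ P X Z
  have hH : Measurable H := by
    have := measurable_mixtureWeight hg hρ_meas P X
    fun_prop
  have hH0 (Z) : 0 ≤ H Z := mul_nonneg (Finset.prod_nonneg fun _ _ => sq_nonneg _)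
    (mixtureWeight_nonneg hρ_nonneg g P X Z)
  have hPeps : Peps d N χ ε ρ P X = ∫ Z, H Z := by
    refine integral_congr_ae (ae_of_all _ fun Z => ?_)
    simp only [H, mixtureWeight]
    rw [← integral_const_mul]
    refine integral_congr_ae (ae_of_all _ fun Y => ?_)
    simp only [← Finset.prod_mul_distrib]
    exact Finset.prod_congr rfl fun k _ => by ring
  have hinner (Z : Fin N → Euc d) :
      ∫ Y : Fin N → Euc d, (Matrix.det (Matrix.of fun i j => g (X j - Z i))) ^ 2 *
          ∏ k, ρ (X k) * (g (Z k - Y k)) ^ 2 / convSq d ρ g (Z k) ∂P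
        = ∑ σ : Equiv.Perm (Fin N), H (Z ∘ σ) := by
    simp only [H, mixtureWeight_comp_perm hg hP_symm, ← Finset.sum_mul, Function.comp_apply]
    rw [mixtureWeight, ← integral_const_mul]
    refine integral_congr_ae ?_
    filter_upwards [hP_supp] with Y hY
    by_cases hZY : ∀ k, g (Z k - Y k) ≠ 0
    · rw [det_chiE_sq hχ_supp hε hεα hY hZY]
    · push Not at hZY
      obtain ⟨k, hk⟩ := hZY
      have h0 : ∏ k, ρ (X k) * (g (Z k - Y k)) ^ 2 / convSq d ρ g (Z k) = 0 :=
        Finset.prod_eq_zero (Finset.mem_univ k) (by simp [hk])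
      rw [h0, mul_zero, mul_zero]
  simp only [hinner]
  rw [integral_sum_comp_of_measurePreserving (fun σ => measurePreserving_comp_perm σ) hH hH0,
    hPeps, Fintype.card_perm, Fintype.card_fin, inv_mul_cancel_left₀]
  exact_mod_cast N.factorial_ne_zero
end
end

section
/- (Kinetic energy of a localized Slater determinant.) Let z₁, …, z_N ∈ ℝ^d satisfy |z_i − z_j| > 2ε for all i ≠ j, so that the functions χ_{ε,z_k}(x) = χ_ε(x − z_k) have pairwise disjoint supports. Then Σ_{ℓ=1}^N ∫_{(ℝ^d)^N} | ∇_{x_ℓ} ( ∏_{m=1}^N √ρ(x_m) · (χ_{ε,z_1} ∧ ⋯ ∧ χ_{ε,z_N})(x₁,…,x_N) ) |² dx₁⋯dx_N = Σ_{j=1}^N ( ∫_{ℝ^d} |∇(√ρ · χ_{ε,z_j})(x)|² dx ) ∏_{k ≠ j} (ρ ∗ χ_ε²)(z_k). -/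
open MeasureTheory Real

noncomputable section

/-- The Slater determinant `(φ₁ ∧ ⋯ ∧ φ_N)(x₁,…,x_N)
  = (N!)^{-1/2} ∑_σ sgn(σ) ∏_k φ_{σ(k)}(x_k)`. -/
def slater (d N : ℕ) (φ : Fin N → Euc d → ℝ) (X : Fin N → Euc d) : ℝ :=
  (Real.sqrt (N.factorial))⁻¹ *
    ∑ σ : Equiv.Perm (Fin N), ((Equiv.Perm.sign σ : ℤ) : ℝ) * ∏ k, φ (σ k) (X k)

theorem norm_sq_sum_smul_of_mul_eq_zero {ι E : Type*} [Fintype ι] [NormedAddCommGroup E]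
    [InnerProductSpace ℝ E] (a : ι → ℝ) (v : ι → E)
    (h : ∀ i j, i ≠ j → a i * a j = 0) :
    ‖∑ i, a i • v i‖ ^ 2 = ∑ i, a i ^ 2 * ‖v i‖ ^ 2 := by
  classical
  rw [← real_inner_self_eq_norm_sq, sum_inner]
  refine Finset.sum_congr rfl fun i _ => ?_
  rw [inner_sum, Finset.sum_eq_single i]
  · rw [real_inner_smul_left, real_inner_smul_right, real_inner_self_eq_norm_sq]
    ring
  · intro j _ hj
    rw [real_inner_smul_left, real_inner_smul_right, ← mul_assoc, h i j hj.symm, zero_mul]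
  · simp

theorem measurable_gradient {d : ℕ} (f : Euc d → ℝ) : Measurable (gradient f) :=
  (InnerProductSpace.toDual ℝ (Euc d)).symm.continuous.measurable.comp (measurable_fderiv ℝ f)

theorem norm_gradient {d : ℕ} (f : Euc d → ℝ) (x : Euc d) : ‖gradient f x‖ = ‖fderiv ℝ f x‖ :=
  (InnerProductSpace.toDual ℝ (Euc d)).symm.norm_map _

theorem exists_pos_bound_of_hasCompactSupport {E F : Type*} [TopologicalSpace E]
    [NormedAddCommGroup F] {g : E → F} (hg : Continuous g) (hs : HasCompactSupport g) :
    ∃ C, 0 ≤ C ∧ ∀ x, ‖g x‖ ≤ C := by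
  obtain ⟨C, hC⟩ := hs.exists_bound_of_continuous hg
  exact ⟨max C 0, le_max_right _ _, fun x => (hC x).trans (le_max_left _ _)⟩

theorem integrable_norm_gradient_mul_sq {d : ℕ} {f g : Euc d → ℝ}
    (hf : ∀ᵐ x, DifferentiableAt ℝ f x) (hf2 : Integrable fun x => f x ^ 2)
    (hdf : Integrable fun x => ‖gradient f x‖ ^ 2)
    (hg : ContDiff ℝ 1 g) (hs : HasCompactSupport g) :
    Integrable fun x => ‖gradient (fun t => f t * g t) x‖ ^ 2 := by
  obtain ⟨C, hC0, hC⟩ := exists_pos_bound_of_hasCompactSupport hg.continuous hs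
  obtain ⟨D, hD0, hD⟩ := exists_pos_bound_of_hasCompactSupport
    (hg.continuous_fderiv one_ne_zero) (hs.fderiv ℝ)
  refine Integrable.mono' ((hf2.const_mul (2 * D ^ 2)).add (hdf.const_mul (2 * C ^ 2)))
    ((measurable_gradient _).norm.pow_const 2).aestronglyMeasurable ?_
  filter_upwards [hf] with x hx
  have hgx : DifferentiableAt ℝ g x := (hg.differentiable one_ne_zero) x
  rw [Real.norm_of_nonneg (by positivity), Pi.add_apply, norm_gradient, norm_gradient,
    fderiv_fun_mul hx hgx]
  have h1 : ‖f x • fderiv ℝ g x + g x • fderiv ℝ f x‖ ≤ D * |f x| + C * ‖fderiv ℝ f x‖ := by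
    refine (norm_add_le _ _).trans (add_le_add ?_ ?_)
    · rw [norm_smul, mul_comm, Real.norm_eq_abs]
      exact mul_le_mul_of_nonneg_right (hD x) (abs_nonneg _)
    · rw [norm_smul]
      exact mul_le_mul_of_nonneg_right (hC x) (norm_nonneg _)
  calc _ ≤ (D * |f x| + C * ‖fderiv ℝ f x‖) ^ 2 := by gcongr
    _ ≤ 2 * ((D * |f x|) ^ 2 + (C * ‖fderiv ℝ f x‖) ^ 2) := add_sq_le
    _ = _ := by rw [mul_pow, mul_pow, sq_abs]; ring

theorem integrable_mul_sq_of_hasCompactSupport {d : ℕ} {ρ g : Euc d → ℝ} (hρ : Integrable ρ)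
    (hg : Continuous g) (hs : HasCompactSupport g) : Integrable fun x => ρ x * g x ^ 2 := by
  obtain ⟨C, hC0, hC⟩ := exists_pos_bound_of_hasCompactSupport hg hs
  refine Integrable.mono' (hρ.norm.const_mul (C ^ 2))
    (hρ.aestronglyMeasurable.mul (hg.pow 2).aestronglyMeasurable) (ae_of_all _ fun x => ?_)
  rw [norm_mul, norm_pow, mul_comm]
  have := hC x
  gcongr

theorem contDiff_chiE_sub {d : ℕ} {χ : Euc d → ℝ} (hχ : ContDiff ℝ 1 χ) (ε : ℝ) (z : Euc d) :
    ContDiff ℝ 1 fun x => chiE d χ ε (x - z) := by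
  unfold chiE
  have h : ContDiff ℝ 1 fun x : Euc d => ε⁻¹ • (x - z) := by fun_prop
  exact contDiff_const.mul (hχ.comp h)

theorem norm_sub_le_of_chiE_ne_zero {d : ℕ} {χ : Euc d → ℝ} {ε : ℝ} (hε : 0 < ε)
    (hχ : Function.support χ ⊆ Metric.closedBall 0 1) {x : Euc d} (hx : chiE d χ ε x ≠ 0) :
    ‖x‖ ≤ ε := by
  have h := hχ (Function.mem_support.2 (right_ne_zero_of_mul hx))
  rw [mem_closedBall_zero_iff, norm_smul, norm_inv, Real.norm_of_nonneg hε.le] at h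
  simpa using (inv_mul_le_iff₀ hε).1 h

theorem hasCompactSupport_chiE_sub {d : ℕ} {χ : Euc d → ℝ} {ε : ℝ} (hε : 0 < ε)
    (hχ : Function.support χ ⊆ Metric.closedBall 0 1) (z : Euc d) :
    HasCompactSupport fun x => chiE d χ ε (x - z) := by
  refine HasCompactSupport.intro (isCompact_closedBall z ε) fun x hx => ?_
  by_contra h
  exact hx (by simpa [dist_eq_norm] using norm_sub_le_of_chiE_ne_zero hε hχ h)

theorem chiE_neg {d : ℕ} {χ : Euc d → ℝ} (hχ : ∀ x y : Euc d, ‖x‖ = ‖y‖ → χ x = χ y)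
    (ε : ℝ) (x : Euc d) : chiE d χ ε (-x) = chiE d χ ε x := by
  unfold chiE
  rw [hχ (ε⁻¹ • -x) (ε⁻¹ • x) (by rw [smul_neg, norm_neg])]

theorem prod_mul_slater (d N : ℕ) (f : Euc d → ℝ) (φ : Fin N → Euc d → ℝ) (T : Fin N → Euc d) :
    (∏ m, f (T m)) * slater d N φ T = slater d N (fun k x => f x * φ k x) T := by
  simp only [slater, Finset.prod_mul_distrib]
  rw [mul_left_comm, Finset.mul_sum]
  congr 1
  exact Finset.sum_congr rfl fun σ _ => by ring

theorem slater_update (d N : ℕ) (φ : Fin N → Euc d → ℝ) (X : Fin N → Euc d) (l : Fin N)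
    (v : Euc d) :
    slater d N φ (Function.update X l v) = ∑ σ : Equiv.Perm (Fin N),
      ((Real.sqrt (N.factorial))⁻¹ * ((Equiv.Perm.sign σ : ℤ) : ℝ)
        * ∏ k ∈ Finset.univ.erase l, φ (σ k) (X k)) * φ (σ l) v := by
  rw [slater, Finset.mul_sum]
  refine Finset.sum_congr rfl fun σ _ => ?_
  rw [← Finset.mul_prod_erase _ _ (Finset.mem_univ l), Function.update_self,
    Finset.prod_congr rfl fun k hk => by rw [Function.update_of_ne (Finset.ne_of_mem_erase hk)]]
  ring

theorem blockGrad_slater (d N : ℕ) (φ : Fin N → Euc d → ℝ) (X : Fin N → Euc d) (l : Fin N)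
    (h : ∀ j, DifferentiableAt ℝ (φ j) (X l)) :
    blockGrad d N (slater d N φ) l X = ∑ σ : Equiv.Perm (Fin N),
      ((Real.sqrt (N.factorial))⁻¹ * ((Equiv.Perm.sign σ : ℤ) : ℝ)
        * ∏ k ∈ Finset.univ.erase l, φ (σ k) (X k)) • gradient (φ (σ l)) (X l) := by
  simp only [blockGrad, slater_update, gradient]
  rw [fderiv_fun_sum fun σ _ => (h (σ l)).const_mul _, map_sum]
  refine Finset.sum_congr rfl fun σ _ => ?_
  rw [fderiv_const_mul (h (σ l)), map_smul]

theorem Equiv.Perm.exists_ne_apply_ne {α : Type*} {σ τ : Equiv.Perm α} (h : σ ≠ τ) (l : α) :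
    ∃ k, k ≠ l ∧ σ k ≠ τ k := by
  by_contra! H
  have hl : σ l ≠ τ l := fun hl => h (Equiv.ext fun k => by
    by_cases hk : k = l
    · rw [hk, hl]
    · exact H k hk)
  obtain ⟨m, hm⟩ := τ.surjective (σ l)
  by_cases hml : m = l
  · exact hl (by rw [← hm, hml])
  · exact hml (σ.injective (by rw [H m hml, hm]))

theorem norm_blockGrad_slater_sq (d N : ℕ) (φ : Fin N → Euc d → ℝ)
    (hφ : ∀ i j, i ≠ j → ∀ x, φ i x * φ j x = 0) (X : Fin N → Euc d) (l : Fin N)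
    (h : ∀ j, DifferentiableAt ℝ (φ j) (X l)) :
    ‖blockGrad d N (slater d N φ) l X‖ ^ 2 = ∑ σ : Equiv.Perm (Fin N),
      (N.factorial : ℝ)⁻¹ * ((∏ k ∈ Finset.univ.erase l, φ (σ k) (X k) ^ 2)
        * ‖gradient (φ (σ l)) (X l)‖ ^ 2) := by
  rw [blockGrad_slater d N φ X l h, norm_sq_sum_smul_of_mul_eq_zero]
  · refine Finset.sum_congr rfl fun σ _ => ?_
    have hs : (((Equiv.Perm.sign σ : ℤ) : ℝ)) ^ 2 = 1 := by
      rcases Int.units_eq_one_or (Equiv.Perm.sign σ) with h | h <;> simp [h]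
    rw [mul_pow, mul_pow, hs, inv_pow, Real.sq_sqrt (Nat.cast_nonneg _), Finset.prod_pow]
    ring
  · intro σ τ hne
    obtain ⟨k, hkl, hk⟩ := Equiv.Perm.exists_ne_apply_ne hne l
    have : (∏ k ∈ Finset.univ.erase l, φ (σ k) (X k)) *
        ∏ k ∈ Finset.univ.erase l, φ (τ k) (X k) = 0 := by
      rw [← Finset.prod_mul_distrib]
      exact Finset.prod_eq_zero (Finset.mem_erase.2 ⟨hkl, Finset.mem_univ k⟩) (hφ _ _ hk _)
    rw [mul_mul_mul_comm, this, mul_zero]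

theorem prod_erase_mul_eq_prod_update {ι E : Type*} [Fintype ι] [DecidableEq ι] (l : ι)
    (f : ι → E → ℝ) (g : E → ℝ) (X : ι → E) :
    (∏ k ∈ Finset.univ.erase l, f k (X k)) * g (X l)
      = ∏ k, Function.update f l g k (X k) := by
  rw [← Finset.prod_erase_mul _ _ (Finset.mem_univ l), Function.update_self]
  congr 1
  exact Finset.prod_congr rfl fun k hk => by
    rw [Function.update_of_ne (Finset.ne_of_mem_erase hk)]

section ProductIntegral

variable {ι E : Type*} [Fintype ι] [DecidableEq ι] [MeasureSpace E]
  [SigmaFinite (volume : Measure E)]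

theorem integrable_prod_erase_mul (l : ι) {f : ι → E → ℝ} {g : E → ℝ}
    (hf : ∀ k, Integrable (f k)) (hg : Integrable g) :
    Integrable fun X : ι → E => (∏ k ∈ Finset.univ.erase l, f k (X k)) * g (X l) := by
  simp only [prod_erase_mul_eq_prod_update]
  refine Integrable.fintype_prod fun k => ?_
  by_cases hk : k = l
  · subst hk; rwa [Function.update_self]
  · rw [Function.update_of_ne hk]; exact hf k

theorem integral_prod_erase_mul (l : ι) (f : ι → E → ℝ) (g : E → ℝ) :
    ∫ X : ι → E, (∏ k ∈ Finset.univ.erase l, f k (X k)) * g (X l)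
      = (∏ k ∈ Finset.univ.erase l, ∫ x, f k x) * ∫ x, g x := by
  simp only [prod_erase_mul_eq_prod_update]
  rw [integral_fintype_prod_volume_eq_prod, ← Finset.prod_erase_mul _ _ (Finset.mem_univ l),
    Function.update_self]
  congr 1
  exact Finset.prod_congr rfl fun k hk => by
    rw [Function.update_of_ne (Finset.ne_of_mem_erase hk)]

end ProductIntegral

theorem sum_integral_norm_blockGrad_slater_sq (d N : ℕ) (φ : Fin N → Euc d → ℝ)
    (hφ : ∀ i j, i ≠ j → ∀ x, φ i x * φ j x = 0)
    (hdiff : ∀ᵐ x, ∀ j, DifferentiableAt ℝ (φ j) x)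
    (hint : ∀ j, Integrable fun x => φ j x ^ 2)
    (hgrad : ∀ j, Integrable fun x => ‖gradient (φ j) x‖ ^ 2) :
    ∑ l, ∫ X : Fin N → Euc d, ‖blockGrad d N (slater d N φ) l X‖ ^ 2
      = ∑ j, (∫ x, ‖gradient (φ j) x‖ ^ 2) * ∏ k ∈ Finset.univ.erase j, ∫ x, φ k x ^ 2 := by
  have key : ∀ l, ∫ X : Fin N → Euc d, ‖blockGrad d N (slater d N φ) l X‖ ^ 2
      = ∑ σ : Equiv.Perm (Fin N), (N.factorial : ℝ)⁻¹ *
        ((∏ k ∈ Finset.univ.erase (σ l), ∫ x, φ k x ^ 2)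
          * ∫ x, ‖gradient (φ (σ l)) x‖ ^ 2) := by
    intro l
    have hae : ∀ᵐ X : Fin N → Euc d, ∀ j, DifferentiableAt ℝ (φ j) (X l) :=
      (Measure.quasiMeasurePreserving_eval (fun _ : Fin N => (volume : Measure (Euc d))) l).ae hdiff
    rw [integral_congr_ae (hae.mono fun X hX => norm_blockGrad_slater_sq d N φ hφ X l hX),
      integral_finsetSum _ fun σ _ => (integrable_prod_erase_mul l
        (f := fun k x => φ (σ k) x ^ 2) (fun k => hint (σ k)) (hgrad (σ l))).const_mul _]
    refine Finset.sum_congr rfl fun σ _ => ?_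
    rw [integral_const_mul, integral_prod_erase_mul l (fun k x => φ (σ k) x ^ 2)
      fun x => ‖gradient (φ (σ l)) x‖ ^ 2]
    congr 2
    exact Finset.prod_equiv σ (by simp) fun _ _ => rfl
  simp_rw [key]
  rw [Finset.sum_comm]
  have inner_sum_eq : ∀ σ : Equiv.Perm (Fin N), ∑ l, (N.factorial : ℝ)⁻¹ *
        ((∏ k ∈ Finset.univ.erase (σ l), ∫ x, φ k x ^ 2) * ∫ x, ‖gradient (φ (σ l)) x‖ ^ 2)
      = (N.factorial : ℝ)⁻¹ * ∑ j, (∫ x, ‖gradient (φ j) x‖ ^ 2) *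
        ∏ k ∈ Finset.univ.erase j, ∫ x, φ k x ^ 2 := by
    intro σ
    rw [← Finset.mul_sum]
    congr 1
    exact Fintype.sum_equiv σ _ _ fun l => mul_comm _ _
  rw [Finset.sum_congr rfl fun σ _ => inner_sum_eq σ, Finset.sum_const, Finset.card_univ,
    Fintype.card_perm, Fintype.card_fin, nsmul_eq_mul, ← mul_assoc,
    mul_inv_cancel₀ (Nat.cast_ne_zero.2 N.factorial_ne_zero), one_mul]

/-- kinetic energy of a localized Slater determinant. -/
theorem slater_kinetic_energy
    (d N : ℕ) (hd : 1 ≤ d) (hN : 2 ≤ N)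
    (χ : Euc d → ℝ) (hχ_smooth : ContDiff ℝ (⊤ : ℕ∞) χ)
    (hχ_supp : Function.support χ ⊆ Metric.closedBall 0 1)
    (hχ_radial : ∀ x y : Euc d, ‖x‖ = ‖y‖ → χ x = χ y)
    (hχ_norm : ∫ x : Euc d, (χ x) ^ 2 = 1)
    (ε : ℝ) (hε : 0 < ε)
    (ρ : Euc d → ℝ) (hρ_nonneg : ∀ x, 0 ≤ ρ x) (hρ_int : Integrable ρ)
    (hsqrt_diff : ∀ᵐ x : Euc d, DifferentiableAt ℝ (fun t => Real.sqrt (ρ t)) x)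
    (hsqrt_gradL2 :
      Integrable (fun x : Euc d => ‖gradient (fun t => Real.sqrt (ρ t)) x‖ ^ 2))
    (z : Fin N → Euc d) (hz : ∀ i j, i ≠ j → 2 * ε < ‖z i - z j‖) :
    ∑ ℓ, ∫ X : Fin N → Euc d,
        ‖blockGrad d N
            (fun T => (∏ m, Real.sqrt (ρ (T m)))
              * slater d N (fun k x => chiE d χ ε (x - z k)) T) ℓ X‖ ^ 2
      = ∑ j, (∫ x : Euc d,
            ‖gradient (fun t => Real.sqrt (ρ t) * chiE d χ ε (t - z j)) x‖ ^ 2)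
          * ∏ k ∈ Finset.univ.erase j, convSq d ρ (chiE d χ ε) (z k) := by
  have hχ1 : ContDiff ℝ 1 χ := hχ_smooth.of_le (by exact_mod_cast le_top)
  have hsm := fun j => contDiff_chiE_sub hχ1 ε (z j)
  have hcs := fun j => hasCompactSupport_chiE_sub hε hχ_supp (z j)
  have hsq : ∀ j x, (Real.sqrt (ρ x) * chiE d χ ε (x - z j)) ^ 2
      = ρ x * chiE d χ ε (x - z j) ^ 2 := fun j x => by
    rw [mul_pow, Real.sq_sqrt (hρ_nonneg x)]
  have hconv : ∀ j, convSq d ρ (chiE d χ ε) (z j)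
      = ∫ x, (Real.sqrt (ρ x) * chiE d χ ε (x - z j)) ^ 2 := fun j => by
    unfold convSq
    refine integral_congr_ae (ae_of_all _ fun x => ?_)
    change ρ x * chiE d χ ε (z j - x) ^ 2 = (Real.sqrt (ρ x) * chiE d χ ε (x - z j)) ^ 2
    rw [hsq, ← chiE_neg hχ_radial ε (x - z j), neg_sub]
  have hslater : (fun T : Fin N → Euc d => (∏ m, Real.sqrt (ρ (T m)))
      * slater d N (fun k x => chiE d χ ε (x - z k)) T)
      = slater d N fun k x => Real.sqrt (ρ x) * chiE d χ ε (x - z k) :=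
    funext fun T => prod_mul_slater d N (fun x => Real.sqrt (ρ x)) _ T
  simp_rw [hslater, hconv]
  refine sum_integral_norm_blockGrad_slater_sq d N
    (fun j x => Real.sqrt (ρ x) * chiE d χ ε (x - z j)) ?_ ?_ ?_ ?_
  · intro i j hij x
    by_contra h
    have hi := norm_sub_le_of_chiE_ne_zero hε hχ_supp
      (right_ne_zero_of_mul (left_ne_zero_of_mul h))
    have hj := norm_sub_le_of_chiE_ne_zero hε hχ_supp
      (right_ne_zero_of_mul (right_ne_zero_of_mul h))
    have := norm_sub_le_norm_sub_add_norm_sub (z i) x (z j)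
    rw [norm_sub_rev (z i) x] at this
    linarith [hz i j hij]
  · filter_upwards [hsqrt_diff] with x hx j
    exact hx.mul ((hsm j).differentiable one_ne_zero x)
  · intro j
    exact (integrable_mul_sq_of_hasCompactSupport hρ_int (hsm j).continuous (hcs j)).congr
      (ae_of_all _ fun x => (hsq j x).symm)
  · intro j
    exact integrable_norm_gradient_mul_sq hsqrt_diff
      (by simpa only [Real.sq_sqrt (hρ_nonneg _)] using hρ_int) hsqrt_gradL2 (hsm j) (hcs j)
end
end
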